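/- Let 2 ≤ p ≤ ∞ and 1 ≤ q ≤ 2. A sequence λ is a multiplier from the Hardy space H_p into ℓ_q if and only if λ ∈ ℓ_r, where 1/r = 1/q − 1/2. -/

import Mathlib

open MeasureTheory Complex Filter Topology Set
open scoped ENNReal

noncomputable section

/-- The `n`-th Taylor coefficient of `f` at `0`. -/
def taylorCoeff (f : ℂ → ℂ) (n : ℕ) : ℂ := iteratedDeriv n f 0 / n.factorial

/-- The `p`-integral mean of `f` on the circle of radius `r` (finite `p`). -/
def circleMean (p : ℝ) (f : ℂ → ℂ) (r : ℝ) : ℝ :=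
  ((1 / (2 * Real.pi)) * ∫ t in (0:ℝ)..(2 * Real.pi),
      ‖f ((r : ℂ) * Complex.exp (t * Complex.I))‖ ^ p) ^ (1 / p)

/-- The sup of `|f|` on the circle of radius `r`. -/
def circleSup (f : ℂ → ℂ) (r : ℝ) : ℝ :=
  ⨆ t : ℝ, ‖f ((r : ℂ) * Complex.exp (t * Complex.I))‖

def hardyMean (p : ℝ≥0∞) (f : ℂ → ℂ) (r : ℝ) : ℝ :=
  if p = ⊤ then circleSup f r else circleMean p.toReal f r

/-- Membership in the Hardy space `H_p` of the unit disk. -/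
def MemHardy (p : ℝ≥0∞) (f : ℂ → ℂ) : Prop :=
  AnalyticOn ℂ f (Metric.ball (0:ℂ) 1) ∧
    BddAbove ((fun r => hardyMean p f r) '' Set.Ico (0:ℝ) 1)

/-- The `H_p` norm: the sup of the `p`-means over radii `0 ≤ r < 1`. -/
def hardyNorm (p : ℝ≥0∞) (f : ℂ → ℂ) : ℝ :=
  sSup ((fun r => hardyMean p f r) '' Set.Ico (0:ℝ) 1)

/-- The `ℓ_q` norm of a sequence. -/
def lqNorm (q : ℝ≥0∞) (x : ℕ → ℂ) : ℝ :=
  if q = ⊤ then ⨆ n, ‖x n‖ else (∑' n, ‖x n‖ ^ q.toReal) ^ (1 / q.toReal)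

/-- Coordinatewise multiplication of sequences. -/
def seqMul (l x : ℕ → ℂ) : ℕ → ℂ := fun n => l n * x n

/-- A Banach sequence lattice on ℤ₊: a Banach ideal space of sequences with monotone norm. -/
structure SeqLattice where
  Mem : (ℕ → ℂ) → Prop
  norm : (ℕ → ℂ) → ℝ
  zero_mem : Mem 0
  add_mem : ∀ x y, Mem x → Mem y → Mem (x + y)
  smul_mem : ∀ (c : ℂ) x, Mem x → Mem (c • x)
  norm_nonneg : ∀ x, 0 ≤ norm x
  norm_eq_zero_iff : ∀ x, Mem x → (norm x = 0 ↔ x = 0)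
  norm_add_le : ∀ x y, Mem x → Mem y → norm (x + y) ≤ norm x + norm y
  norm_smul : ∀ (c : ℂ) x, Mem x → norm (c • x) = ‖c‖ * norm x
  ideal : ∀ x y, Mem x → (∀ n, ‖y n‖ ≤ ‖x n‖) → Mem y ∧ norm y ≤ norm x
  complete : ∀ u : ℕ → (ℕ → ℂ), (∀ m, Mem (u m)) →
    (∀ ε : ℝ, 0 < ε → ∃ N, ∀ m ≥ N, ∀ n ≥ N, norm (u m - u n) ≤ ε) →
    ∃ x, Mem x ∧ Tendsto (fun m => norm (u m - x)) atTop (𝓝 0)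

/-- Order continuity: every nonnegative, pointwise nonincreasing sequence of elements of `E`
converging pointwise to `0` converges to `0` in the norm of `E`. -/
def OrderContinuous (E : SeqLattice) : Prop :=
  ∀ u : ℕ → ℕ → ℝ,
    (∀ m, E.Mem fun k => (u m k : ℂ)) →
    (∀ m k, 0 ≤ u m k) →
    (∀ k, Antitone fun m => u m k) →
    (∀ k, Tendsto (fun m => u m k) atTop (𝓝 0)) →
    Tendsto (fun m => E.norm fun k => (u m k : ℂ)) atTop (𝓝 0)

/-- A set of sequences is solid if it is an ideal. -/
def IsSolid (S : Set (ℕ → ℂ)) : Prop :=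
  ∀ x ∈ S, ∀ y : ℕ → ℂ, (∀ n, ‖y n‖ ≤ ‖x n‖) → y ∈ S

/-- The solid hull: the smallest solid set containing `A`. -/
def solidHull (A : Set (ℕ → ℂ)) : Set (ℕ → ℂ) := ⋂₀ {S | IsSolid S ∧ A ⊆ S}

/-- The set of multipliers from `F` into `E`. -/
def MultSet (F E : Set (ℕ → ℂ)) : Set (ℕ → ℂ) := {l | ∀ x ∈ F, seqMul l x ∈ E}

/-- A Banach space of analytic functions on the unit disk. -/
structure AnalBanach where
  Mem : (ℂ → ℂ) → Prop
  norm : (ℂ → ℂ) → ℝ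
  analytic : ∀ f, Mem f → AnalyticOn ℂ f (Metric.ball (0:ℂ) 1)
  zero_mem : Mem 0
  add_mem : ∀ f g, Mem f → Mem g → Mem (f + g)
  smul_mem : ∀ (c : ℂ) f, Mem f → Mem (c • f)
  norm_nonneg : ∀ f, 0 ≤ norm f
  norm_eq_zero_iff : ∀ f, Mem f → (norm f = 0 ↔ ∀ z ∈ Metric.ball (0:ℂ) 1, f z = 0)
  norm_add_le : ∀ f g, Mem f → Mem g → norm (f + g) ≤ norm f + norm g
  norm_smul : ∀ (c : ℂ) f, Mem f → norm (c • f) = ‖c‖ * norm f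
  complete : ∀ u : ℕ → (ℂ → ℂ), (∀ m, Mem (u m)) →
    (∀ ε : ℝ, 0 < ε → ∃ N, ∀ m ≥ N, ∀ n ≥ N, norm (u m - u n) ≤ ε) →
    ∃ f, Mem f ∧ Tendsto (fun m => norm (u m - f)) atTop (𝓝 0)

/-- The Taylor coefficient space `X̂` of a space of analytic functions. -/
def coeffSpace (X : AnalBanach) : Set (ℕ → ℂ) := {a | ∃ f, X.Mem f ∧ a = taylorCoeff f}

/-- `H_p ↪ X` continuously. -/
def EmbedHardyIn (p : ℝ≥0∞) (X : AnalBanach) : Prop :=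
  ∃ C : ℝ, 0 < C ∧ ∀ f, MemHardy p f → X.Mem f ∧ X.norm f ≤ C * hardyNorm p f

/-- `X ↪ H_p` continuously. -/
def EmbedInHardy (X : AnalBanach) (p : ℝ≥0∞) : Prop :=
  ∃ C : ℝ, 0 < C ∧ ∀ f, X.Mem f → MemHardy p f ∧ hardyNorm p f ≤ C * X.norm f

/-- Hausdorff measure of noncompactness of a set in a Banach sequence lattice. -/
def hmnc (E : SeqLattice) (A : Set (ℕ → ℂ)) : ℝ :=
  sInf {ε : ℝ | 0 < ε ∧ ∃ Z : Finset (ℕ → ℂ),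
    (∀ z ∈ Z, E.Mem z) ∧ ∀ x ∈ A, ∃ z ∈ Z, E.norm (x - z) ≤ ε}

/-- Hausdorff measure of noncompactness of a set of sequences in the `ℓ_q` metric. -/
def hmncLq (q : ℝ≥0∞) (A : Set (ℕ → ℂ)) : ℝ :=
  sInf {ε : ℝ | 0 < ε ∧ ∃ Z : Finset (ℕ → ℂ), ∀ x ∈ A, ∃ z ∈ Z, lqNorm q (x - z) ≤ ε}

/-- Relative compactness (total boundedness) of a set in a Banach sequence lattice. -/
def RelCompactIn (E : SeqLattice) (A : Set (ℕ → ℂ)) : Prop :=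
  ∀ ε : ℝ, 0 < ε → ∃ Z : Finset (ℕ → ℂ),
    (∀ z ∈ Z, E.Mem z) ∧ ∀ x ∈ A, ∃ z ∈ Z, E.norm (x - z) ≤ ε

/-- Relative compactness (total boundedness) of a set of sequences in `ℓ_q`. -/
def RelCompactInLq (q : ℝ≥0∞) (A : Set (ℕ → ℂ)) : Prop :=
  ∀ ε : ℝ, 0 < ε → ∃ Z : Finset (ℕ → ℂ), ∀ x ∈ A, ∃ z ∈ Z, lqNorm q (x - z) ≤ ε

/-- The closed unit ball of `H_p`. -/
def hardyBall (p : ℝ≥0∞) : Set (ℂ → ℂ) := {f | MemHardy p f ∧ hardyNorm p f ≤ 1}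

/-- The multiplier operator `M_λ : H_p → ℓ_q` is (bounded into `ℓ_q` and) compact. -/
def MulCompactHardyLq (p q : ℝ≥0∞) (l : ℕ → ℂ) : Prop :=
  (∀ f, MemHardy p f → Memℓp (seqMul l (taylorCoeff f)) q) ∧
  RelCompactInLq q ((fun f => seqMul l (taylorCoeff f)) '' hardyBall p)

/-- The multiplier operator `M_λ : X → E` maps `X` into `E` and is compact. -/
def MulCompactX (X : AnalBanach) (E : SeqLattice) (l : ℕ → ℂ) : Prop :=
  (∀ f, X.Mem f → E.Mem (seqMul l (taylorCoeff f))) ∧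
  RelCompactIn E ((fun f => seqMul l (taylorCoeff f)) '' {f | X.Mem f ∧ X.norm f ≤ 1})



lemma coef_avg {f : ℂ → ℂ} {R : ℝ} (hR : 0 < R) (hf : DiffContOnCl ℂ f (Metric.ball 0 R)) (n : ℕ) :
    Real.circleAverage (fun z => (z⁻¹) ^ n * f z) 0 R = taylorCoeff f n := by
  rw [Real.circleAverage_eq_circleIntegral hR.ne']
  have h := DiffContOnCl.circleIntegral_one_div_sub_center_pow_smul hR n hf
  have e : (∮ z in C(0, R), (z - 0)⁻¹ • ((z⁻¹) ^ n * f z))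
      = ∮ z in C(0, R), (1 / (z - 0) ^ (n + 1)) • f z := by
    congr 1; ext z; simp only [sub_zero, smul_eq_mul, pow_succ, one_div, mul_inv, inv_pow]; ring
  rw [e, h, taylorCoeff]
  simp only [smul_eq_mul]
  field_simp

lemma coef_avg_one {f : ℂ → ℂ} {R : ℝ} (hR : 0 < R) (hf : DiffContOnCl ℂ f (Metric.ball 0 R))
    (n : ℕ) :
    Real.circleAverage (fun z => (starRingEnd ℂ z) ^ n * f (R * z)) 0 1
      = (R : ℂ) ^ n * taylorCoeff f n := by
  rw [← coef_avg hR hf n, Real.circleAverage_eq_circleAverage_zero_one (R := R)]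
  rw [← smul_eq_mul, ← Real.circleAverage_fun_smul]
  apply Real.circleAverage_congr_sphere
  intro z hz
  have hz' : ‖z‖ = 1 := by simpa using hz
  have : starRingEnd ℂ z = z⁻¹ := by
    rw [Complex.inv_def, Complex.normSq_eq_norm_sq, hz']; simp
  have hR' : (R : ℂ) ≠ 0 := by exact_mod_cast hR.ne'
  simp only [this, add_zero, smul_eq_mul, mul_inv, mul_pow, inv_pow]
  field_simp

/-- The analytic completion of `|F|^2` for a polynomial `F`. -/
lemma exists_G (a : ℕ → ℂ) (N : ℕ) : ∃ G : ℂ → ℂ, Differentiable ℂ G ∧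
    G 0 = ((∑ n ∈ Finset.range N, ‖a n‖ ^ 2 : ℝ) : ℂ) ∧
    ∀ z : ℂ, ‖z‖ = 1 → (G z).re = ‖∑ n ∈ Finset.range N, a n * z ^ n‖ ^ 2 := by
  induction N with
  | zero => exact ⟨fun _ => 0, by fun_prop, by simp, by simp⟩
  | succ N ih =>
    obtain ⟨G, hG, h0, h1⟩ := ih
    refine ⟨fun z => G z + ((‖a N‖ ^ 2 : ℝ) : ℂ) +
      2 * (a N * ∑ m ∈ Finset.range N, starRingEnd ℂ (a m) * z ^ (N - m)), by fun_prop, ?_, ?_⟩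
    · simp only [h0, Finset.sum_range_succ]
      have : ∑ m ∈ Finset.range N, starRingEnd ℂ (a m) * (0 : ℂ) ^ (N - m) = 0 := by
        apply Finset.sum_eq_zero
        intro m hm
        have := Finset.mem_range.1 hm
        rw [zero_pow (by omega), mul_zero]
      rw [this]; push_cast; ring
    · intro z hz
      have key : ∑ m ∈ Finset.range N, starRingEnd ℂ (a m) * z ^ (N - m)
          = z ^ N * starRingEnd ℂ (∑ n ∈ Finset.range N, a n * z ^ n) := by
        rw [map_sum, Finset.mul_sum]
        apply Finset.sum_congr rfl
        intro m hm
        have hm := Finset.mem_range.1 hm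
        have hz2 : z * starRingEnd ℂ z = 1 := by
          rw [Complex.mul_conj, Complex.normSq_eq_norm_sq, hz]; simp
        obtain ⟨k, rfl⟩ : ∃ k, N = k + m := ⟨N - m, by omega⟩
        rw [Nat.add_sub_cancel, map_mul, map_pow]
        calc _ = starRingEnd ℂ (a m) * z ^ k * (z * starRingEnd ℂ z) ^ m := by rw [hz2]; simp
          _ = _ := by rw [mul_pow, pow_add]; ring
      beta_reduce
      rw [key, Finset.sum_range_succ]
      set P := ∑ n ∈ Finset.range N, a n * z ^ n
      have h2 : (G z).re = ‖P‖ ^ 2 := h1 z hz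
      have h3 : ‖a N‖ ^ 2 = ‖a N * z ^ N‖ ^ 2 := by rw [norm_mul, norm_pow, hz]; simp
      rw [h3, ← mul_assoc (a N)]
      set w := a N * z ^ N
      rw [Complex.add_re, Complex.add_re, h2]
      simp only [← Complex.normSq_eq_norm_sq, Complex.normSq_apply, Complex.ofReal_re]
      simp
      ring

lemma ci_of_cont {E : Type*} [NormedAddCommGroup E] {f : ℂ → E} (hf : Continuous f) :
    CircleIntegrable f 0 1 := hf.continuousOn.circleIntegrable zero_le_one

lemma avg_re {f : ℂ → ℂ} (hf : CircleIntegrable f 0 1) :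
    Real.circleAverage (fun z => (f z).re) 0 1 = (Real.circleAverage f 0 1).re :=
  ContinuousLinearMap.circleAverage_comp_comm Complex.reCLM hf

lemma avg_sq (a : ℕ → ℂ) (N : ℕ) :
    Real.circleAverage (fun z => ‖∑ n ∈ Finset.range N, a n * z ^ n‖ ^ 2) 0 1
      = ∑ n ∈ Finset.range N, ‖a n‖ ^ 2 := by
  obtain ⟨G, hG, h0, h1⟩ := exists_G a N
  rw [← Real.circleAverage_congr_sphere (f₁ := fun z => (G z).re)
    (fun z hz => h1 z (by simpa using hz)), avg_re (ci_of_cont hG.continuous),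
    DiffContOnCl.circleAverage hG.diffContOnCl, h0, Complex.ofReal_re]

lemma exists_signs (l : ℕ → ℂ) (N : ℕ) : ∃ a : ℕ → ℂ, (∀ n, ‖a n‖ = ‖l n‖) ∧
    Real.circleAverage (fun z => ‖∑ n ∈ Finset.range N, a n * z ^ n‖ ^ 4) 0 1
      ≤ 3 * (∑ n ∈ Finset.range N, ‖l n‖ ^ 2) ^ 2 := by
  induction N with
  | zero => exact ⟨l, fun _ => rfl, by simp [Real.circleAverage_const]⟩
  | succ N ih =>
    obtain ⟨a, ha, h⟩ := ih
    have hsq := avg_sq a N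
    simp only [ha] at hsq
    set P : ℂ → ℂ := fun z => ∑ n ∈ Finset.range N, a n * z ^ n with hP
    have hPc : Continuous P := by fun_prop
    set S := ∑ n ∈ Finset.range N, ‖l n‖ ^ 2
    have hS : 0 ≤ S := by positivity
    set A1 := Real.circleAverage (fun z => ‖P z + l N * z ^ N‖ ^ 4) 0 1 with hA1
    set A2 := Real.circleAverage (fun z => ‖P z + -l N * z ^ N‖ ^ 4) 0 1 with hA2
    have key : A1 + A2 ≤ 2 * (3 * (S + ‖l N‖ ^ 2) ^ 2) := by
      rw [hA1, hA2, ← Real.circleAverage_fun_add (ci_of_cont (by fun_prop)) (ci_of_cont (by fun_prop))]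
      have h2 : Real.circleAverage (fun z => ‖P z + l N * z ^ N‖ ^ 4 + ‖P z + -l N * z ^ N‖ ^ 4) 0 1
        ≤ Real.circleAverage (fun z => ((2 : ℝ) • ‖P z‖ ^ 4 + (12 * ‖l N‖ ^ 2) • ‖P z‖ ^ 2)
            + 2 * ‖l N‖ ^ 4) 0 1 := by
        apply Real.circleAverage_mono (ci_of_cont (by fun_prop)) (ci_of_cont (by fun_prop))
        intro z hz
        have hz' : ‖z‖ = 1 := by simpa using hz
        have h3 : ‖l N‖ = ‖l N * z ^ N‖ := by rw [norm_mul, norm_pow, hz']; simp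
        rw [h3, neg_mul]
        generalize l N * z ^ N = w
        generalize P z = v
        have e : ∀ x : ℂ, ‖x‖ ^ 4 = (x.re * x.re + x.im * x.im) ^ 2 := by
          intro x
          rw [← Complex.normSq_apply, Complex.normSq_eq_norm_sq]; ring
        have e2 : ∀ x : ℂ, ‖x‖ ^ 2 = (x.re * x.re + x.im * x.im) := by
          intro x
          rw [← Complex.normSq_apply, Complex.normSq_eq_norm_sq]
        simp only [e, e2, smul_eq_mul, Complex.add_re, Complex.add_im, Complex.neg_re, Complex.neg_im]
        nlinarith [sq_nonneg (v.re * w.im - v.im * w.re)]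
      refine h2.trans ?_
      rw [Real.circleAverage_fun_add (ci_of_cont (by fun_prop)) (ci_of_cont (by fun_prop)),
        Real.circleAverage_fun_add (ci_of_cont (by fun_prop)) (ci_of_cont (by fun_prop)),
        Real.circleAverage_fun_smul, Real.circleAverage_fun_smul, hsq, Real.circleAverage_const]
      simp only [smul_eq_mul]
      nlinarith [pow_nonneg (norm_nonneg (l N)) 4]
    have hsum : ∀ (b z : ℂ), ∑ n ∈ Finset.range (N + 1), Function.update a N b n * z ^ n
        = P z + b * z ^ N := by
      intro b z
      rw [Finset.sum_range_succ, Function.update_self]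
      congr 1
      apply Finset.sum_congr rfl
      intro n hn
      have := Finset.mem_range.1 hn
      rw [Function.update_of_ne (by omega)]
    have hn : ∀ b : ℂ, ‖b‖ = ‖l N‖ → ∀ n, ‖Function.update a N b n‖ = ‖l n‖ := by
      intro b hb n
      by_cases hn : n = N
      · subst hn; simp [hb]
      · simp [hn, ha]
    rw [Finset.sum_range_succ]
    by_cases hc : A1 ≤ 3 * (S + ‖l N‖ ^ 2) ^ 2
    · refine ⟨Function.update a N (l N), hn _ rfl, ?_⟩
      simp only [hsum]; exact hc
    · refine ⟨Function.update a N (-l N), hn _ (by simp), ?_⟩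
      simp only [hsum]
      have : A2 ≤ 3 * (S + ‖l N‖ ^ 2) ^ 2 := by linarith
      exact this
lemma pair_avg {f : ℂ → ℂ} (a c : ℕ → ℂ) (N : ℕ)
    (hf : ContinuousOn f (Metric.sphere 0 1))
    (hc : ∀ n, Real.circleAverage (fun z => (starRingEnd ℂ z) ^ n * f z) 0 1 = c n) :
    Real.circleAverage (fun z => starRingEnd ℂ (∑ n ∈ Finset.range N, a n * z ^ n) * f z) 0 1
      = ∑ n ∈ Finset.range N, starRingEnd ℂ (a n) * c n := by
  have e : (fun z : ℂ => starRingEnd ℂ (∑ n ∈ Finset.range N, a n * z ^ n) * f z)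
      = fun z => ∑ n ∈ Finset.range N, starRingEnd ℂ (a n) • ((starRingEnd ℂ z) ^ n * f z) := by
    ext z
    rw [map_sum, Finset.sum_mul]
    apply Finset.sum_congr rfl
    intro n _
    simp only [map_mul, map_pow, smul_eq_mul]; ring
  rw [e, Real.circleAverage_fun_sum]
  · apply Finset.sum_congr rfl
    intro n _
    rw [Real.circleAverage_fun_smul, hc, smul_eq_mul]
  · intro n _
    apply ContinuousOn.circleIntegrable zero_le_one
    exact (ContinuousOn.mul (f := fun z : ℂ => (starRingEnd ℂ z) ^ n) (by fun_prop) hf).const_smul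
      (starRingEnd ℂ (a n))

lemma test_fun (l : ℕ → ℂ) (N : ℕ) (hS : 0 < ∑ n ∈ Finset.range N, ‖l n‖ ^ 2) :
    ∃ f : ℂ → ℂ, DifferentiableOn ℂ f (Metric.ball 0 1) ∧
      (∀ z ∈ Metric.ball (0 : ℂ) 1, ‖f z‖ ≤ 3 / 2 * √(∑ n ∈ Finset.range N, ‖l n‖ ^ 2)) ∧
      (∑ n ∈ Finset.range N, ‖l n‖ ^ 2) / 2 ≤
        ∑ n ∈ Finset.range N, ‖l n‖ * ‖taylorCoeff f n‖ := by
  obtain ⟨a, ha, h4⟩ := exists_signs l N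
  obtain ⟨G, hG, hG0, hG1⟩ := exists_G a N
  have hsq := avg_sq a N
  simp only [ha] at hG0 hsq
  set S := ∑ n ∈ Finset.range N, ‖l n‖ ^ 2 with hSdef
  set F : ℂ → ℂ := fun z => ∑ n ∈ Finset.range N, a n * z ^ n with hF
  have hFd : Differentiable ℂ F := by fun_prop
  set δ : ℝ := 1 / (9 * S) with hδ
  have hδ0 : 0 < δ := by positivity
  set D : ℂ → ℂ := fun z => 1 + δ * G z with hD
  have hDd : Differentiable ℂ D := by fun_prop
  have hfr : frontier (Metric.ball (0 : ℂ) 1) = Metric.sphere 0 1 := frontier_ball _ one_ne_zero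
  have hcl : closure (Metric.ball (0 : ℂ) 1) = Metric.closedBall 0 1 := closure_ball _ one_ne_zero
  have hre : ∀ z ∈ Metric.closedBall (0 : ℂ) 1, 0 ≤ (G z).re := by
    intro z hz
    have h := Complex.norm_le_of_forall_mem_frontier_norm_le (U := Metric.ball (0 : ℂ) 1)
      (f := fun z => Complex.exp (-G z)) Metric.isBounded_ball
      (Differentiable.diffContOnCl (by fun_prop)) (C := 1) ?_ (z := z) (by rwa [hcl])
    · rw [Complex.norm_exp, Real.exp_le_one_iff] at h
      simpa using h
    · intro w hw
      rw [hfr] at hw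
      rw [Complex.norm_exp, Real.exp_le_one_iff, Complex.neg_re, hG1 w (by simpa using hw)]
      have := sq_nonneg ‖∑ n ∈ Finset.range N, a n * w ^ n‖
      linarith
  have hDre : ∀ z, (D z).re = 1 + δ * (G z).re := by
    intro z; simp [hD]
  have hDre1 : ∀ z ∈ Metric.closedBall (0 : ℂ) 1, 1 ≤ (D z).re := by
    intro z hz
    have := mul_nonneg hδ0.le (hre z hz)
    rw [hDre]; linarith
  have hDn : ∀ z ∈ Metric.closedBall (0 : ℂ) 1, 1 ≤ ‖D z‖ := fun z hz =>
    (hDre1 z hz).trans (Complex.re_le_norm _)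
  have hDne : ∀ z ∈ Metric.closedBall (0 : ℂ) 1, D z ≠ 0 := by
    intro z hz h0
    have := hDn z hz
    rw [h0, norm_zero] at this
    linarith
  set f : ℂ → ℂ := fun z => F z / D z with hf
  have hfd : ∀ z ∈ Metric.closedBall (0 : ℂ) 1, DifferentiableAt ℂ f z := fun z hz =>
    (hFd z).div (hDd z) (hDne z hz)
  have hfdc : DiffContOnCl ℂ f (Metric.ball 0 1) := by
    refine ⟨fun z hz => (hfd z (Metric.ball_subset_closedBall hz)).differentiableWithinAt, ?_⟩
    rw [hcl]
    exact fun z hz => (hfd z hz).continuousAt.continuousWithinAt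
  refine ⟨f, hfdc.differentiableOn, ?_, ?_⟩
  · intro z hz
    apply Complex.norm_le_of_forall_mem_frontier_norm_le (U := Metric.ball (0 : ℂ) 1)
      Metric.isBounded_ball hfdc ?_ (by rw [hcl]; exact Metric.ball_subset_closedBall hz)
    intro w hw
    rw [hfr] at hw
    have hw1 := Metric.sphere_subset_closedBall hw
    have h1 : (G w).re = ‖F w‖ ^ 2 := hG1 w (by simpa using hw)
    have h2 : 1 + δ * ‖F w‖ ^ 2 ≤ ‖D w‖ := by
      rw [← h1, ← hDre]; exact Complex.re_le_norm _
    rw [hf]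
    simp only [norm_div]
    rw [div_le_iff₀ (by linarith [hDn w hw1])]
    have hs : 0 < √S := Real.sqrt_pos.2 hS
    have hss : √S * √S = S := Real.mul_self_sqrt hS.le
    have h3 : ‖F w‖ ≤ 3 / 2 * √S * (1 + δ * ‖F w‖ ^ 2) := by
      have : 3 / 2 * √S * (1 + δ * ‖F w‖ ^ 2) - ‖F w‖ = (3 * √S - ‖F w‖) ^ 2 / (6 * √S) := by
        have hδ2 : δ = 1 / (9 * (√S * √S)) := by rw [hss]
        rw [hδ2]; field_simp; ring
      have h5 : 0 ≤ (3 * √S - ‖F w‖) ^ 2 / (6 * √S) := by positivity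
      linarith
    exact h3.trans (by gcongr)
  · have hcs : ContinuousOn f (Metric.sphere 0 1) := fun z hz =>
      (hfd z (Metric.sphere_subset_closedBall hz)).continuousAt.continuousWithinAt
    have hp := pair_avg a (fun n => taylorCoeff f n) N hcs (by
      intro n
      have := coef_avg_one one_pos hfdc n
      simpa using this)
    have hInt0 : CircleIntegrable (fun z => starRingEnd ℂ (F z) * f z) 0 1 := by
      apply ContinuousOn.circleIntegrable zero_le_one
      have : Continuous F := hFd.continuous
      exact ContinuousOn.mul (by fun_prop) hcs
    have hGc : Continuous G := hG.continuous
    have hFc : Continuous F := hFd.continuous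
    have h5 : Real.circleAverage (fun z => ‖F z‖ ^ 2 + ((-(3 * δ / 2)) • ‖F z‖ ^ 4
        + (δ / 2) • (G z ^ 2).re)) 0 1 ≤
        Real.circleAverage (fun z => (starRingEnd ℂ (F z) * f z).re) 0 1 := by
      apply Real.circleAverage_mono (ci_of_cont (by fun_prop))
      · apply ContinuousOn.circleIntegrable zero_le_one
        apply Complex.continuous_re.comp_continuousOn
        exact ContinuousOn.mul (by fun_prop) hcs
      intro z hz
      have hz1 : ‖z‖ = 1 := by simpa using hz
      have hzc : z ∈ Metric.closedBall (0 : ℂ) 1 := by simp [hz1]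
      have h1 : (G z).re = ‖F z‖ ^ 2 := hG1 z hz1
      have hne := hDne z hzc
      have e1 : starRingEnd ℂ (F z) * f z
          = ((‖F z‖ ^ 2 : ℝ) : ℂ) - ((‖F z‖ ^ 2 * δ : ℝ) : ℂ) * (G z / D z) := by
        have : (D z) = 1 + δ * G z := rfl
        rw [hf]
        simp only
        rw [mul_div_assoc', mul_comm, Complex.mul_conj, Complex.normSq_eq_norm_sq]
        field_simp
        rw [this]; push_cast; ring
      have e2 : (G z / D z).re ≤ ‖G z‖ := by
        refine (Complex.re_le_norm _).trans ?_
        rw [norm_div]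
        exact div_le_self (norm_nonneg _) (hDn z hzc)
      have e3 : ‖G z‖ ^ 2 = 2 * ‖F z‖ ^ 4 - (G z ^ 2).re := by
        have : ‖F z‖ ^ 4 = (G z).re ^ 2 := by rw [h1]; ring
        rw [this, ← Complex.normSq_eq_norm_sq, Complex.normSq_apply, pow_two (G z), Complex.mul_re]
        ring
      rw [e1, Complex.sub_re, Complex.re_ofReal_mul, Complex.ofReal_re]
      have e4 : ‖F z‖ ^ 2 * δ * (G z / D z).re ≤ ‖F z‖ ^ 2 * δ * ‖G z‖ := by gcongr
      have e5 : ‖F z‖ ^ 2 * ‖G z‖ ≤ (‖F z‖ ^ 4 + ‖G z‖ ^ 2) / 2 := by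
        nlinarith [sq_nonneg (‖F z‖ ^ 2 - ‖G z‖)]
      have e6 := mul_le_mul_of_nonneg_left e5 hδ0.le
      rw [e3] at e6
      simp only [smul_eq_mul]
      linarith
    rw [avg_re hInt0, hp, Real.circleAverage_fun_add (ci_of_cont (by fun_prop)) (ci_of_cont (by fun_prop)),
      Real.circleAverage_fun_add (ci_of_cont (by fun_prop)) (ci_of_cont (by fun_prop)),
      Real.circleAverage_fun_smul, Real.circleAverage_fun_smul, hsq,
      avg_re (f := fun z => G z ^ 2) (ci_of_cont (by fun_prop)),
      DiffContOnCl.circleAverage (f := fun z => G z ^ 2) (Differentiable.diffContOnCl (by fun_prop)),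
      hG0] at h5
    have h6 : (((S : ℝ) : ℂ) ^ 2).re = S ^ 2 := by rw [← Complex.ofReal_pow, Complex.ofReal_re]
    rw [h6] at h5
    simp only [smul_eq_mul] at h5
    have h7 : (∑ n ∈ Finset.range N, starRingEnd ℂ (a n) * taylorCoeff f n).re
        ≤ ∑ n ∈ Finset.range N, ‖l n‖ * ‖taylorCoeff f n‖ := by
      refine (Complex.re_le_norm _).trans ((norm_sum_le _ _).trans (le_of_eq ?_))
      apply Finset.sum_congr rfl
      intro n _
      rw [norm_mul, RCLike.norm_conj, ha]
    refine le_trans ?_ (h5.trans h7)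
    have h8 : 3 * δ / 2 * Real.circleAverage (fun z => ‖F z‖ ^ 4) 0 1 ≤ 3 * δ / 2 * (3 * S ^ 2) := by
      gcongr
    have h9 : δ * S ^ 2 = S / 9 := by rw [hδ]; field_simp
    nlinarith [mul_nonneg hδ0.le (sq_nonneg S)]
/-- Bounded functions on `ℂ` which are holomorphic on the unit disk. -/
def holoSub : Submodule ℂ (lp (fun _ : ℂ => ℂ) ∞) where
  carrier := {f | DifferentiableOn ℂ (f : ℂ → ℂ) (Metric.ball 0 1)}
  zero_mem' := by
    simp only [Set.mem_ofPred_eq, lp.coeFn_zero]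
    exact differentiableOn_const 0
  add_mem' := by
    intro f g hf hg
    simp only [Set.mem_ofPred_eq, lp.coeFn_add] at *
    exact hf.add hg
  smul_mem' := by
    intro c f hf
    simp only [Set.mem_ofPred_eq, lp.coeFn_smul] at *
    exact hf.const_smul c

lemma holoSub_closed : IsClosed (holoSub : Set (lp (fun _ : ℂ => ℂ) ∞)) := by
  apply IsSeqClosed.isClosed
  intro u f hu hf
  change DifferentiableOn ℂ (f : ℂ → ℂ) (Metric.ball 0 1)
  have : TendstoLocallyUniformlyOn (fun n => (u n : ℂ → ℂ)) (f : ℂ → ℂ) atTop (Metric.ball 0 1) := by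
    apply TendstoUniformlyOn.tendstoLocallyUniformlyOn
    rw [Metric.tendstoUniformlyOn_iff]
    intro ε hε
    filter_upwards [Metric.tendsto_nhds.1 hf ε hε] with n hn z _
    refine lt_of_le_of_lt ?_ hn
    rw [dist_comm, dist_eq_norm, dist_eq_norm]
    exact lp.norm_apply_le_norm ENNReal.top_ne_zero (u n - f) z
  exact this.differentiableOn (Eventually.of_forall hu) Metric.isOpen_ball

instance : CompleteSpace holoSub := holoSub_closed.completeSpace_coe

lemma contDiffAt_of_diffOn {f : ℂ → ℂ} (hf : DifferentiableOn ℂ f (Metric.ball 0 1)) (n : ℕ) :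
    ContDiffAt ℂ n f 0 :=
  (hf.analyticAt (Metric.ball_mem_nhds _ one_pos)).contDiffAt

lemma coef_bound {f : ℂ → ℂ} (hf : DifferentiableOn ℂ f (Metric.ball 0 1)) {M : ℝ}
    (hM : ∀ z ∈ Metric.ball (0 : ℂ) 1, ‖f z‖ ≤ M) (n : ℕ) : ‖taylorCoeff f n‖ ≤ 2 ^ n * M := by
  have hsub : Metric.closedBall (0 : ℂ) (1 / 2) ⊆ Metric.ball 0 1 :=
    Metric.closedBall_subset_ball (by norm_num)
  have h := Complex.norm_iteratedDeriv_le_of_forall_mem_sphere_norm_le (c := 0) (R := 1 / 2) (f := f)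
    n (by norm_num) ((hf.mono (by rwa [closure_ball _ (by norm_num)])).diffContOnCl)
    (fun z hz => hM z (hsub (Metric.sphere_subset_closedBall hz)))
  rw [taylorCoeff, norm_div, Complex.norm_natCast, div_le_iff₀ (by positivity)]
  refine h.trans (le_of_eq ?_)
  rw [one_div, inv_pow, div_inv_eq_mul]; ring

/-- Taylor coefficient functional. -/
def coefL (n : ℕ) : holoSub →L[ℂ] ℂ :=
  LinearMap.mkContinuous
    { toFun := fun f => taylorCoeff (f.1 : ℂ → ℂ) n
      map_add' := by
        intro f g
        simp only [taylorCoeff, Submodule.coe_add, lp.coeFn_add]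
        rw [iteratedDeriv_add (contDiffAt_of_diffOn f.2 n) (contDiffAt_of_diffOn g.2 n), add_div]
      map_smul' := by
        intro c f
        simp only [taylorCoeff, Submodule.coe_smul, lp.coeFn_smul]
        rw [iteratedDeriv_const_smul (contDiffAt_of_diffOn f.2 n)]
        simp [mul_div_assoc] }
    (2 ^ n) (by
      intro f
      exact coef_bound f.2 (fun z _ => lp.norm_apply_le_norm ENNReal.top_ne_zero f.1 z) n)

lemma coefL_apply (n : ℕ) (f : holoSub) : coefL n f = taylorCoeff (f.1 : ℂ → ℂ) n := rfl

lemma uniform_bound (l : ℕ → ℂ) (q : ℝ≥0∞) (hq : 0 < q.toReal)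
    (h : ∀ f : ℂ → ℂ, DifferentiableOn ℂ f (Metric.ball 0 1) →
      (∃ M : ℝ, ∀ z ∈ Metric.ball (0 : ℂ) 1, ‖f z‖ ≤ M) → Memℓp (seqMul l (taylorCoeff f)) q) :
    ∃ C : ℝ, 0 ≤ C ∧ ∀ f : ℂ → ℂ, DifferentiableOn ℂ f (Metric.ball 0 1) → ∀ M : ℝ, 0 ≤ M →
      (∀ z ∈ Metric.ball (0 : ℂ) 1, ‖f z‖ ≤ M) → ∀ (N : ℕ) (w : ℕ → ℝ), (∀ n, 0 ≤ w n) →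
      (∀ x : ℕ → ℝ, (∀ n, 0 ≤ x n) → ∑ n ∈ Finset.range N, w n * x n ≤
        (∑ n ∈ Finset.range N, x n ^ q.toReal) ^ (1 / q.toReal)) →
      ∑ n ∈ Finset.range N, w n * ‖l n‖ * ‖taylorCoeff f n‖ ≤ C * M := by
  let ι := {i : ℕ × (ℕ → ℂ) // ∀ x : ℕ → ℝ, (∀ n, 0 ≤ x n) →
    ∑ n ∈ Finset.range i.1, ‖i.2 n‖ * x n ≤
        (∑ n ∈ Finset.range i.1, x n ^ q.toReal) ^ (1 / q.toReal)}
  let g : ι → holoSub →L[ℂ] ℂ := fun i =>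
    ∑ n ∈ Finset.range i.1.1, (i.1.2 n * l n) • coefL n
  have hg : ∀ (i : ι) (f : holoSub), g i f
      = ∑ n ∈ Finset.range i.1.1, (i.1.2 n * l n) * taylorCoeff (f.1 : ℂ → ℂ) n := by
    intro i f
    simp only [g, sum_apply, smul_apply, coefL_apply,
      smul_eq_mul]
  obtain ⟨C, hC⟩ := banach_steinhaus (g := g) (by
    intro f
    have hs := (memℓp_gen_iff hq).1 (h f.1 f.2
      ⟨‖f.1‖, fun z _ => lp.norm_apply_le_norm ENNReal.top_ne_zero f.1 z⟩)
    refine ⟨(∑' n, ‖seqMul l (taylorCoeff f.1) n‖ ^ q.toReal) ^ (1 / q.toReal), ?_⟩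
    intro i
    rw [hg]
    refine (norm_sum_le _ _).trans ?_
    have h1 := i.2 (fun n => ‖seqMul l (taylorCoeff f.1) n‖) (fun n => norm_nonneg _)
    refine le_trans (le_of_eq ?_) (h1.trans ?_)
    · apply Finset.sum_congr rfl
      intro n _
      simp only [seqMul, norm_mul, mul_assoc]
    · apply Real.rpow_le_rpow (by positivity) _ (by positivity)
      exact hs.sum_le_tsum _ (fun n _ => by positivity))
  refine ⟨max C 0, le_max_right _ _, ?_⟩
  intro f hf M hM0 hM N w hw0 hw
  let F : ℂ → ℂ := Set.indicator (Metric.ball 0 1) f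
  have hFb : ∀ z, ‖F z‖ ≤ M := by
    intro z
    by_cases hz : z ∈ Metric.ball (0 : ℂ) 1
    · simp only [F, Set.indicator_of_mem hz]; exact hM z hz
    · simp only [F, Set.indicator_of_notMem hz, norm_zero]; exact hM0
  have hFm : Memℓp (E := fun _ : ℂ => ℂ) F ∞ := memℓp_infty ⟨M, by rintro _ ⟨z, rfl⟩; exact hFb z⟩
  have hFd : DifferentiableOn ℂ F (Metric.ball 0 1) :=
    hf.congr (fun z hz => Set.indicator_of_mem hz f)
  let Φ : holoSub := ⟨⟨F, hFm⟩, hFd⟩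
  have hΦ : ‖Φ‖ ≤ M := lp.norm_le_of_forall_le hM0 hFb
  have hcoef : ∀ n, taylorCoeff F n = taylorCoeff f n := by
    intro n
    unfold taylorCoeff
    congr 1
    apply Filter.EventuallyEq.iteratedDeriv_eq
    filter_upwards [Metric.ball_mem_nhds (0 : ℂ) one_pos] with z hz
    exact Set.indicator_of_mem hz f
  let y : ℕ → ℂ := fun n => l n * taylorCoeff f n
  let θ : ℕ → ℂ := fun n => w n * (starRingEnd ℂ (y n) / ‖y n‖)
  have hθ : ∀ n, ‖θ n‖ ≤ w n := by
    intro n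
    simp only [θ, norm_mul, norm_div, RCLike.norm_conj, Complex.norm_real, norm_norm]
    rw [Real.norm_of_nonneg (hw0 n)]
    exact mul_le_of_le_one_right (hw0 n) (div_self_le_one _)
  have hθy : ∀ n, θ n * y n = ((w n * ‖y n‖ : ℝ) : ℂ) := by
    intro n
    by_cases hy : y n = 0
    · simp [hy]
    · have : (‖y n‖ : ℂ) ≠ 0 := by simpa using hy
      simp only [θ]
      rw [mul_assoc, div_mul_eq_mul_div, mul_comm (starRingEnd ℂ (y n)), Complex.mul_conj,
        Complex.normSq_eq_norm_sq]
      push_cast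
      field_simp
  let i : ι := ⟨(N, θ), by
    intro x hx
    refine le_trans (Finset.sum_le_sum ?_) (hw x hx)
    intro n _
    exact mul_le_mul_of_nonneg_right (hθ n) (hx n)⟩
  have h1 : ‖g i Φ‖ ≤ max C 0 * M := by
    refine (ContinuousLinearMap.le_opNorm _ _).trans ?_
    exact mul_le_mul ((hC i).trans (le_max_left _ _)) hΦ (norm_nonneg _) (le_max_right _ _)
  have h2 : g i Φ = ((∑ n ∈ Finset.range N, w n * ‖l n‖ * ‖taylorCoeff f n‖ : ℝ) : ℂ) := by
    rw [hg, Complex.ofReal_sum]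
    apply Finset.sum_congr rfl
    intro n _
    change θ n * l n * taylorCoeff F n = _
    rw [hcoef, mul_assoc (θ n)]
    refine (hθy n).trans ?_
    simp only [y, norm_mul, mul_assoc]
  rw [h2, Complex.norm_real] at h1
  exact (le_abs_self _).trans h1

lemma sq_sum_bound (l : ℕ → ℂ) (q : ℝ≥0∞) (hq : 0 < q.toReal)
    (h : ∀ f : ℂ → ℂ, DifferentiableOn ℂ f (Metric.ball 0 1) →
      (∃ M : ℝ, ∀ z ∈ Metric.ball (0 : ℂ) 1, ‖f z‖ ≤ M) → Memℓp (seqMul l (taylorCoeff f)) q) :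
    ∃ C : ℝ, 0 ≤ C ∧ ∀ (N : ℕ) (w : ℕ → ℝ), (∀ n, 0 ≤ w n) →
      (∀ x : ℕ → ℝ, (∀ n, 0 ≤ x n) → ∑ n ∈ Finset.range N, w n * x n ≤
        (∑ n ∈ Finset.range N, x n ^ q.toReal) ^ (1 / q.toReal)) →
      ∑ n ∈ Finset.range N, (w n * ‖l n‖) ^ 2 ≤ C := by
  obtain ⟨C, hC0, hC⟩ := uniform_bound l q hq h
  refine ⟨9 * C ^ 2, by positivity, ?_⟩
  intro N w hw0 hw
  have hn : ∀ n, ‖((w n : ℂ) * l n)‖ = w n * ‖l n‖ := by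
    intro n
    rw [norm_mul, Complex.norm_real, Real.norm_of_nonneg (hw0 n)]
  have ht := test_fun (fun n => (w n : ℂ) * l n) N
  simp only [hn] at ht
  set S := ∑ n ∈ Finset.range N, (w n * ‖l n‖) ^ 2 with hS
  by_cases hS0 : 0 < S
  · obtain ⟨f, hf, hb, hs⟩ := ht hS0
    have h1 := hC f hf (3 / 2 * √S) (by positivity) hb N w hw0 hw
    have h2 : √S * √S = S := Real.mul_self_sqrt hS0.le
    have h3 : 0 < √S := Real.sqrt_pos.2 hS0
    have h4 : √S * √S ≤ √S * (3 * C) := by nlinarith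
    have h5 : √S ≤ 3 * C := le_of_mul_le_mul_left h4 h3
    nlinarith
  · have : 0 ≤ C ^ 2 := sq_nonneg C
    linarith
lemma circleMean_eq (p : ℝ) (f : ℂ → ℂ) (r : ℝ) :
    circleMean p f r = (Real.circleAverage (fun z => ‖f (r * z)‖ ^ p) 0 1) ^ (1 / p) := by
  simp [circleMean, Real.circleAverage, circleMap]

lemma cont_sphere {f : ℂ → ℂ} (hf : DifferentiableOn ℂ f (Metric.ball 0 1)) {r : ℝ}
    (hr0 : 0 ≤ r) (hr1 : r < 1) :
    ContinuousOn (fun z : ℂ => f (r * z)) (Metric.sphere 0 1) := by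
  apply ContinuousOn.comp hf.continuousOn (by fun_prop)
  intro z hz
  have hz1 : ‖z‖ = 1 := by simpa using hz
  simp [hz1, abs_of_nonneg hr0, hr1]

lemma memHardy_of_bounded {p : ℝ≥0∞} (hp : 2 ≤ p) {f : ℂ → ℂ}
    (hf : DifferentiableOn ℂ f (Metric.ball 0 1)) {M : ℝ}
    (hM : ∀ z ∈ Metric.ball (0 : ℂ) 1, ‖f z‖ ≤ M) : MemHardy p f := by
  have hM0 : 0 ≤ M := (norm_nonneg _).trans (hM 0 (Metric.mem_ball_self one_pos))
  have hb : ∀ r ∈ Set.Ico (0 : ℝ) 1, ∀ z : ℂ, ‖z‖ = 1 → ‖f (r * z)‖ ≤ M := by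
    intro r hr z hz
    apply hM
    simp [hz, abs_of_nonneg hr.1, hr.2]
  refine ⟨hf.analyticOn Metric.isOpen_ball, M, ?_⟩
  rintro _ ⟨r, hr, rfl⟩
  simp only [hardyMean]
  split_ifs with hpt
  · apply ciSup_le
    intro t
    exact hb r hr _ (Complex.norm_exp_ofReal_mul_I t)
  · have hp0 : 0 < p.toReal := ENNReal.toReal_pos (by intro h; simp [h] at hp) hpt
    rw [circleMean_eq]
    have hci : CircleIntegrable (fun z : ℂ => ‖f (r * z)‖ ^ p.toReal) 0 1 := by
      apply ContinuousOn.circleIntegrable zero_le_one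
      exact (cont_sphere hf hr.1 hr.2).norm.rpow_const (fun _ _ => Or.inr hp0.le)
    have h1 : Real.circleAverage (fun z => ‖f (r * z)‖ ^ p.toReal) 0 1 ≤ M ^ p.toReal := by
      apply Real.circleAverage_mono_on_of_le_circle hci
      intro z hz
      exact Real.rpow_le_rpow (norm_nonneg _) (hb r hr z (by simpa using hz)) hp0.le
    have h0 : 0 ≤ Real.circleAverage (fun z => ‖f (r * z)‖ ^ p.toReal) 0 1 := by
      apply Real.circleAverage_nonneg_of_nonneg
      intro z hz
      positivity
    calc _ ≤ (M ^ p.toReal) ^ (1 / p.toReal) := Real.rpow_le_rpow h0 h1 (by positivity)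
      _ = M := by rw [← Real.rpow_mul hM0, mul_one_div_cancel hp0.ne', Real.rpow_one]

lemma bessel {f : ℂ → ℂ} (hf : DifferentiableOn ℂ f (Metric.ball 0 1)) {r : ℝ}
    (hr0 : 0 < r) (hr1 : r < 1) (N : ℕ) :
    ∑ n ∈ Finset.range N, ‖(r : ℂ) ^ n * taylorCoeff f n‖ ^ 2
      ≤ Real.circleAverage (fun z => ‖f (r * z)‖ ^ 2) 0 1 := by
  have hc := cont_sphere hf hr0.le hr1
  have hfd : DiffContOnCl ℂ f (Metric.ball 0 r) := by
    apply DifferentiableOn.diffContOnCl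
    rw [closure_ball _ hr0.ne']
    exact hf.mono (Metric.closedBall_subset_ball hr1)
  set a : ℕ → ℂ := fun n => (r : ℂ) ^ n * taylorCoeff f n with ha
  have hp := pair_avg a a N hc (fun n => coef_avg_one hr0 hfd n)
  have hsq := avg_sq a N
  set P : ℂ → ℂ := fun z => ∑ n ∈ Finset.range N, a n * z ^ n with hP
  have hPc : Continuous P := by fun_prop
  have hcm : ContinuousOn (fun z => starRingEnd ℂ (P z) * f (r * z)) (Metric.sphere 0 1) :=
    ContinuousOn.mul (by fun_prop) hc
  have hci : CircleIntegrable (fun z => starRingEnd ℂ (P z) * f (r * z)) 0 1 :=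
    hcm.circleIntegrable zero_le_one
  have hci2 : CircleIntegrable (fun z => (2 : ℝ) • (starRingEnd ℂ (P z) * f (r * z)).re) 0 1 := by
    apply ContinuousOn.circleIntegrable zero_le_one
    exact (Complex.continuous_re.comp_continuousOn hcm).const_smul (2 : ℝ)
  have h1 : Real.circleAverage (fun z => (2 : ℝ) • (starRingEnd ℂ (P z) * f (r * z)).re - ‖P z‖ ^ 2) 0 1
      ≤ Real.circleAverage (fun z => ‖f (r * z)‖ ^ 2) 0 1 := by
    apply Real.circleAverage_mono (hci2.sub (ci_of_cont (by fun_prop)))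
      ((hc.norm.pow 2).circleIntegrable zero_le_one)
    intro z _
    change (2:ℝ) • (starRingEnd ℂ (P z) * f (r * z)).re - ‖P z‖ ^ 2 ≤ ‖f (r * z)‖ ^ 2
    generalize f (r * z) = u
    generalize P z = v
    simp only [← Complex.normSq_eq_norm_sq, Complex.normSq_apply, smul_eq_mul, Complex.mul_re,
      Complex.conj_re, Complex.conj_im]
    nlinarith [sq_nonneg (u.re - v.re), sq_nonneg (u.im - v.im)]
  rw [Real.circleAverage_fun_sub hci2 (ci_of_cont (by fun_prop)), Real.circleAverage_fun_smul,
    avg_re hci, hp, hsq] at h1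
  have h2 : (∑ n ∈ Finset.range N, starRingEnd ℂ (a n) * a n).re
      = ∑ n ∈ Finset.range N, ‖a n‖ ^ 2 := by
    rw [Complex.re_sum]
    apply Finset.sum_congr rfl
    intro n _
    rw [mul_comm, Complex.mul_conj, Complex.normSq_eq_norm_sq, Complex.ofReal_re]
  rw [h2, smul_eq_mul] at h1
  linarith

lemma hardy_sq_summable {p : ℝ≥0∞} (hp : 2 ≤ p) {f : ℂ → ℂ} (hf : MemHardy p f) :
    Summable fun n => ‖taylorCoeff f n‖ ^ 2 := by
  obtain ⟨hfa, B, hB⟩ := hf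
  have hfd : DifferentiableOn ℂ f (Metric.ball 0 1) := hfa.differentiableOn
  have hK : ∃ K : ℝ, ∀ r : ℝ, 0 < r → r < 1 →
      Real.circleAverage (fun z => ‖f (r * z)‖ ^ 2) 0 1 ≤ K := by
    by_cases hpt : p = ⊤
    · refine ⟨B ^ 2, ?_⟩
      intro r hr0 hr1
      have h1 : circleSup f r ≤ B := by
        have := hB ⟨r, ⟨hr0.le, hr1⟩, rfl⟩
        simpa [hardyMean, hpt] using this
      have hc := cont_sphere hfd hr0.le hr1
      obtain ⟨A, hA⟩ := (isCompact_sphere (0 : ℂ) 1).exists_bound_of_continuousOn hc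
      apply Real.circleAverage_mono_on_of_le_circle ((hc.norm.pow 2).circleIntegrable zero_le_one)
      intro z hz
      have hz1 : ‖z‖ = 1 := by simpa using hz
      obtain ⟨t, ht⟩ : ∃ t : ℝ, Complex.exp (t * Complex.I) = z := by
        refine ⟨Complex.arg z, ?_⟩
        have := Complex.norm_mul_exp_arg_mul_I z
        simpa [hz1] using this
      have h2 : ‖f (r * z)‖ ≤ circleSup f r := by
        rw [← ht]
        apply le_ciSup (f := fun t : ℝ => ‖f (r * Complex.exp (t * Complex.I))‖)
        refine ⟨A, ?_⟩
        rintro _ ⟨s, rfl⟩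
        exact hA _ (by simp [Complex.norm_exp_ofReal_mul_I])
      exact pow_le_pow_left₀ (norm_nonneg _) (h2.trans h1) 2
    · have hp2 : 2 ≤ p.toReal := by
        have := ENNReal.toReal_mono hpt hp
        simpa using this
      have hp0 : 0 < p.toReal := by linarith
      refine ⟨1 + B ^ p.toReal, ?_⟩
      intro r hr0 hr1
      have h1 : circleMean p.toReal f r ≤ B := by
        have := hB ⟨r, ⟨hr0.le, hr1⟩, rfl⟩
        simpa [hardyMean, hpt] using this
      rw [circleMean_eq] at h1
      have hc := cont_sphere hfd hr0.le hr1
      have hci : CircleIntegrable (fun z : ℂ => ‖f (r * z)‖ ^ p.toReal) 0 1 := by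
        apply ContinuousOn.circleIntegrable zero_le_one
        exact hc.norm.rpow_const (fun _ _ => Or.inr hp0.le)
      have h0 : 0 ≤ Real.circleAverage (fun z => ‖f (r * z)‖ ^ p.toReal) 0 1 := by
        apply Real.circleAverage_nonneg_of_nonneg
        intro z hz
        positivity
      have h2 : Real.circleAverage (fun z => ‖f (r * z)‖ ^ p.toReal) 0 1 ≤ B ^ p.toReal := by
        have := Real.rpow_le_rpow (Real.rpow_nonneg h0 _) h1 hp0.le
        rwa [← Real.rpow_mul h0, one_div_mul_cancel hp0.ne', Real.rpow_one] at this
      have h3 : Real.circleAverage (fun z => ‖f (r * z)‖ ^ 2) 0 1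
          ≤ Real.circleAverage (fun z => 1 + ‖f (r * z)‖ ^ p.toReal) 0 1 := by
        apply Real.circleAverage_mono ((hc.norm.pow 2).circleIntegrable zero_le_one)
          ((circleIntegrable_const _ _ _).add hci)
        intro z _
        change ‖f (r * z)‖ ^ 2 ≤ 1 + ‖f (r * z)‖ ^ p.toReal
        generalize hx : ‖f (r * z)‖ = x
        have hx0 : 0 ≤ x := hx ▸ norm_nonneg _
        rcases le_total x 1 with h | h
        · have : 0 ≤ x ^ p.toReal := Real.rpow_nonneg hx0 _
          nlinarith
        · have := Real.rpow_le_rpow_of_exponent_le h hp2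
          rw [Real.rpow_two] at this
          linarith
      rw [Real.circleAverage_fun_add (circleIntegrable_const _ _ _) hci,
        Real.circleAverage_const] at h3
      linarith
  obtain ⟨K, hK⟩ := hK
  apply summable_of_sum_range_le (c := K) (fun n => by positivity)
  intro N
  have hcont : Continuous fun r : ℝ => ∑ n ∈ Finset.range N, ‖(r : ℂ) ^ n * taylorCoeff f n‖ ^ 2 := by
    fun_prop
  have ht : Tendsto (fun r : ℝ => ∑ n ∈ Finset.range N, ‖(r : ℂ) ^ n * taylorCoeff f n‖ ^ 2)
      (𝓝[<] 1) (𝓝 (∑ n ∈ Finset.range N, ‖taylorCoeff f n‖ ^ 2)) := by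
    have := (hcont.tendsto 1).mono_left (nhdsWithin_le_nhds (s := Set.Iio 1))
    simpa using this
  apply le_of_tendsto ht
  filter_upwards [Ioo_mem_nhdsLT (show (0 : ℝ) < 1 from one_pos)] with r hr
  exact (bessel hfd hr.1 hr.2 N).trans (hK r hr.1 hr.2)
lemma weight_bound (l : ℕ → ℂ) (s t C : ℝ) (hs : 1 ≤ s) (ht : 0 < t) (hst : 1 / t = 1 / s - 1 / 2)
    (hC0 : 0 ≤ C)
    (h : ∀ (N : ℕ) (w : ℕ → ℝ), (∀ n, 0 ≤ w n) →
      (∀ x : ℕ → ℝ, (∀ n, 0 ≤ x n) → ∑ n ∈ Finset.range N, w n * x n ≤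
        (∑ n ∈ Finset.range N, x n ^ s) ^ (1 / s)) →
      ∑ n ∈ Finset.range N, (w n * ‖l n‖) ^ 2 ≤ C) (N : ℕ) :
    ∑ n ∈ Finset.range N, ‖l n‖ ^ t ≤ C ^ (t / 2) := by
  set R := ∑ n ∈ Finset.range N, ‖l n‖ ^ t with hR
  have hs0 : 0 < s := by linarith
  by_cases hR0 : 0 < R
  swap
  · exact (not_lt.1 hR0).trans (Real.rpow_nonneg hC0 _)
  have hu : ∀ n, 0 ≤ ‖l n‖ ^ t / R := fun n => by positivity
  have h1 := h N (fun n => (‖l n‖ ^ t / R) ^ (1 - 1 / s)) (fun n => Real.rpow_nonneg (hu n) _) ?_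
  · have e : ∀ n, ((‖l n‖ ^ t / R) ^ (1 - 1 / s) * ‖l n‖) ^ 2
        = ‖l n‖ ^ t * R ^ (2 / t - 1) := by
      intro n
      rcases (norm_nonneg (l n)).eq_or_lt with h0 | h0
      · rw [← h0, Real.zero_rpow ht.ne']; simp
      · have e1 : 1 - 1 / s = 1 / 2 - 1 / t := by linarith
        rw [e1, Real.div_rpow (by positivity) hR0.le, ← Real.rpow_mul h0.le, ← Real.rpow_natCast,
          Real.mul_rpow (by positivity) h0.le, Real.div_rpow (by positivity) (by positivity),
          ← Real.rpow_mul h0.le, ← Real.rpow_mul hR0.le, div_eq_mul_inv, ← Real.rpow_neg hR0.le,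
          mul_right_comm, ← Real.rpow_add h0]
        congr 2
        · push_cast; field_simp; ring
        · push_cast; ring
    simp only [e, ← Finset.sum_mul] at h1
    rw [← hR] at h1
    have e2 : R * R ^ (2 / t - 1) = R ^ (2 / t) := by
      nth_rewrite 1 [← Real.rpow_one R]
      rw [← Real.rpow_add hR0]; congr 1; ring
    rw [e2] at h1
    have h2 := Real.rpow_le_rpow (by positivity) h1 (show 0 ≤ t / 2 by positivity)
    rw [← Real.rpow_mul hR0.le] at h2
    have e3 : 2 / t * (t / 2) = 1 := by field_simp
    rwa [e3, Real.rpow_one] at h2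
  · intro x hx
    rcases hs.eq_or_lt with h1 | h1
    · subst h1
      simp
    · have hc := Real.HolderConjugate.conjExponent h1
      have h2 := Real.inner_le_Lp_mul_Lq_of_nonneg (Finset.range N) hc.symm
        (f := fun n => (‖l n‖ ^ t / R) ^ (1 - 1 / s)) (g := x)
        (fun n _ => Real.rpow_nonneg (hu n) _) (fun n _ => hx n)
      refine h2.trans (le_of_eq ?_)
      have e : ∑ n ∈ Finset.range N, ((‖l n‖ ^ t / R) ^ (1 - 1 / s)) ^ (s.conjExponent) = 1 := by
        have : ∀ n, ((‖l n‖ ^ t / R) ^ (1 - 1 / s)) ^ (s.conjExponent) = ‖l n‖ ^ t / R := by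
          intro n
          rw [← Real.rpow_mul (hu n)]
          have : (1 - 1 / s) * s.conjExponent = 1 := by
            have : s - 1 ≠ 0 := by linarith
            unfold Real.conjExponent
            field_simp
          rw [this, Real.rpow_one]
        simp only [this, ← Finset.sum_div]
        exact div_self hR0.ne'
      rw [e, Real.one_rpow, one_mul]

/-- For `2 ≤ p ≤ ∞` and `1 ≤ q ≤ 2`, `λ ∈ M(H_p, ℓ_q)` iff `λ ∈ ℓ_r` with `1/r = 1/q - 1/2`. -/
theorem stmt_4 (p q r : ℝ≥0∞) (hp : 2 ≤ p) (hq1 : 1 ≤ q) (hq2 : q ≤ 2)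
    (hr : 1 / r = 1 / q - 1 / 2) (l : ℕ → ℂ) :
    (∀ f, MemHardy p f → Memℓp (seqMul l (taylorCoeff f)) q) ↔ Memℓp l r := by
  have hqt : q ≠ ⊤ := ne_top_of_le_ne_top ENNReal.ofNat_ne_top hq2
  have hs1 : 1 ≤ q.toReal := by
    have := ENNReal.toReal_mono hqt hq1
    simpa using this
  have hs0 : 0 < q.toReal := by linarith
  have hq0 : q ≠ 0 := by intro h; simp [h] at hq1
  have key : (∀ f, MemHardy p f → Memℓp (seqMul l (taylorCoeff f)) q) → _ := fun h =>
    sq_sum_bound l q hs0 (fun f hf ⟨M, hM⟩ => h f (memHardy_of_bounded hp hf hM))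
  by_cases hq : q = 2
  · have hrt : r = ⊤ := by
      rw [hq, tsub_self] at hr
      simpa using hr
    subst hrt
    have h2 : (2 : ℝ≥0∞).toReal = 2 := by simp
    constructor
    · intro h
      obtain ⟨C, hC0, hC⟩ := key h
      apply memℓp_infty
      refine ⟨√C, ?_⟩
      rintro _ ⟨n, rfl⟩
      have h1 := hC (n + 1) (fun m => if m = n then 1 else 0)
        (fun m => by split_ifs <;> norm_num) ?_
      · apply Real.le_sqrt_of_sq_le
        simpa [ite_mul, ite_pow, Finset.sum_ite_eq] using h1
      · intro x hx
        have e : ∑ m ∈ Finset.range (n + 1), (if m = n then (1 : ℝ) else 0) * x m = x n := by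
          simp [ite_mul, Finset.sum_ite_eq]
        rw [e]
        calc x n = (x n ^ q.toReal) ^ (1 / q.toReal) := by
              rw [← Real.rpow_mul (hx n), mul_one_div_cancel hs0.ne', Real.rpow_one]
          _ ≤ _ := by
              apply Real.rpow_le_rpow (Real.rpow_nonneg (hx n) _) _ (by positivity)
              exact Finset.single_le_sum (f := fun m => x m ^ q.toReal)
                (fun m _ => Real.rpow_nonneg (hx m) _) (Finset.self_mem_range_succ n)
    · intro hl f hf
      obtain ⟨B, hB⟩ := hl.bddAbove
      have hsum := hardy_sq_summable hp hf
      rw [memℓp_gen_iff hs0, hq, h2]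
      simp only [Real.rpow_two]
      refine Summable.of_nonneg_of_le (fun n => by positivity) ?_ (hsum.mul_left (B ^ 2))
      intro n
      have : ‖l n‖ ≤ B := hB ⟨n, rfl⟩
      rw [seqMul, norm_mul, mul_pow]
      gcongr
  · have hlt : q < 2 := lt_of_le_of_ne hq2 hq
    have hs2 : q.toReal < 2 := by
      have := (ENNReal.toReal_lt_toReal hqt ENNReal.ofNat_ne_top).2 hlt
      simpa using this
    have hreal : 1 / r.toReal = 1 / q.toReal - 1 / 2 := by
      have := congrArg ENNReal.toReal hr
      rw [ENNReal.toReal_sub_of_le (ENNReal.div_le_div_left hq2 1) (by simp [hq0])] at this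
      simpa using this
    have hpos : 0 < 1 / q.toReal - 1 / 2 := by
      have := one_div_lt_one_div_of_lt hs0 hs2
      linarith
    have ht0 : 0 < r.toReal := by
      rw [← hreal] at hpos
      exact one_div_pos.1 hpos
    constructor
    · intro h
      obtain ⟨C, hC0, hC⟩ := key h
      rw [memℓp_gen_iff ht0]
      exact summable_of_sum_range_le (fun n => by positivity)
        (weight_bound l q.toReal r.toReal C hs1 ht0 hreal hC0 hC)
    · intro hl f hf
      have hsum := hardy_sq_summable hp hf
      rw [memℓp_gen_iff ht0] at hl
      rw [memℓp_gen_iff hs0]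
      set s := q.toReal
      set t := r.toReal
      have hconj : (t / s).HolderConjugate (2 / s) := by
        rw [Real.holderConjugate_iff]
        have h3 : s / t = 1 - s / 2 := by
          have : s / t = s * (1 / t) := by ring
          rw [this, hreal]; field_simp
        constructor
        · have : s / t < 1 := by rw [h3]; linarith
          rw [lt_div_iff₀ hs0]
          rw [div_lt_one ht0] at this
          linarith
        · rw [inv_div, inv_div, h3]; ring
      refine Summable.of_nonneg_of_le (fun n => by positivity) ?_
        ((hl.div_const (t / s)).add (hsum.div_const (2 / s)))
      intro n
      have := Real.young_inequality_of_nonneg (Real.rpow_nonneg (norm_nonneg (l n)) s)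
        (Real.rpow_nonneg (norm_nonneg (taylorCoeff f n)) s) hconj
      rw [← Real.rpow_mul (norm_nonneg _), ← Real.rpow_mul (norm_nonneg _),
        mul_div_cancel₀ _ hs0.ne', mul_div_cancel₀ _ hs0.ne', Real.rpow_two] at this
      rw [seqMul, norm_mul, Real.mul_rpow (norm_nonneg _) (norm_nonneg _)]
      exact this
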